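/- arXiv:1012.0898 — 2 statements merged into one kernel-verified Lean document; each statement's English description precedes it below -/
import Mathlib

section
/- For every even positive integer n and every nonzero vector x ∈ F_4^n of even Hamming weight, the number of Hermitian self-dual codes of length n containing x equals ∏_{i=0}^{n/2−2}(2^{2i+1}+1). -/
abbrev F4 := GaloisField 2 2

/-- Hermitian inner product on `F4^n`. -/
noncomputable def hIP {n : ℕ} (x y : Fin n → F4) : F4 := ∑ i, x i * (y i) ^ 2

/-- Hamming weight. -/
noncomputable def wt {n : ℕ} (x : Fin n → F4) : ℕ := Nat.card {i : Fin n // x i ≠ 0}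

/-- Hermitian dual code. -/
noncomputable def hDual {n : ℕ} (C : Submodule F4 (Fin n → F4)) : Submodule F4 (Fin n → F4) where
  carrier := {x | ∀ c ∈ C, hIP x c = 0}
  add_mem' := by
    intro a b ha hb c hc
    have h : hIP (a + b) c = hIP a c + hIP b c := by
      simp [hIP, add_mul, Finset.sum_add_distrib]
    simp only [h, ha c hc, hb c hc, add_zero]
  zero_mem' := by intro c hc; simp [hIP]
  smul_mem' := by
    intro r x hx c hc
    have h : hIP (r • x) c = r * hIP x c := by
      simp [hIP, Finset.mul_sum, mul_assoc]
    simp only [h, hx c hc, mul_zero]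

/-- Monomial transformation given by permutation `π` and nonzero scalars `s`. -/
noncomputable def monomialMap {n : ℕ} (π : Equiv.Perm (Fin n)) (s : Fin n → F4ˣ) :
    (Fin n → F4) →ₗ[F4] (Fin n → F4) where
  toFun x := fun i => (s i : F4) * x (π i)
  map_add' := by intro x y; funext i; simp [mul_add]
  map_smul' := by intro r x; funext i; simp [mul_comm, mul_left_comm]

/-- Monomial equivalence of codes. -/
noncomputable def CodeEquiv {n : ℕ} (C C' : Submodule F4 (Fin n → F4)) : Prop :=
  ∃ (π : Equiv.Perm (Fin n)) (s : Fin n → F4ˣ), C.map (monomialMap π s) = C'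

/-- Order of the automorphism group (monomial transformations preserving `C`). -/
noncomputable def autCard {n : ℕ} (C : Submodule F4 (Fin n → F4)) : ℕ :=
  Nat.card {p : Equiv.Perm (Fin n) × (Fin n → F4ˣ) // C.map (monomialMap p.1 p.2) = C}

/-- Direct sum of two codes. -/
noncomputable def dsum {n₁ n₂ : ℕ} (C₁ : Submodule F4 (Fin n₁ → F4)) (C₂ : Submodule F4 (Fin n₂ → F4)) :
    Submodule F4 (Fin (n₁ + n₂) → F4) :=
  (C₁.comap (LinearMap.funLeft F4 F4 (Fin.castAdd n₂))) ⊓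
    (C₂.comap (LinearMap.funLeft F4 F4 (Fin.natAdd n₁)))


open Classical in
noncomputable instance instFintypeF4 : Fintype F4 := Fintype.ofFinite F4

lemma F4_card : Fintype.card F4 = 4 := by
  have := GaloisField.card 2 2 (by norm_num)
  rw [Nat.card_eq_fintype_card] at this
  simpa using this

lemma F4_pow4 (a : F4) : a ^ 4 = a := by
  have := FiniteField.pow_card a
  rwa [F4_card] at this

lemma F4_two : (2 : F4) = 0 := by
  have := CharP.cast_eq_zero F4 2
  exact_mod_cast this

lemma F4_add_self (a : F4) : a + a = 0 := by
  rw [← two_mul, F4_two, zero_mul]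

open Classical in
/-- sign -/
noncomputable def eps (a : F4) : ℤ := if a = 0 then 1 else -1

lemma eps_zero : eps 0 = 1 := by simp [eps]

lemma eps_ne {a : F4} (h : a ≠ 0) : eps a = -1 := by simp [eps, h]

lemma idem_cases {a : F4} (h : a ^ 2 = a) : a = 0 ∨ a = 1 := by
  have : a * (a - 1) = 0 := by linear_combination h
  rcases mul_eq_zero.1 this with h | h
  · exact Or.inl h
  · exact Or.inr (sub_eq_zero.1 h)

lemma eps_add {a b : F4} (ha : a ^ 2 = a) (hb : b ^ 2 = b) : eps (a + b) = eps a * eps b := by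
  rcases idem_cases ha with rfl | rfl <;> rcases idem_cases hb with rfl | rfl <;>
    simp [eps, F4_add_self]

/-- trace -/
noncomputable def tr4 (a : F4) : F4 := a + a ^ 2

lemma tr4_add (a b : F4) : tr4 (a + b) = tr4 a + tr4 b := by
  simp only [tr4]; linear_combination a * b * F4_two

lemma tr4_idem (a : F4) : tr4 a ^ 2 = tr4 a := by
  simp only [tr4]; linear_combination a ^ 3 * F4_two + F4_pow4 a

lemma tr4_sq (a : F4) : tr4 (a ^ 2) = tr4 a := by
  simp only [tr4]; linear_combination F4_pow4 a

lemma exists_tr4 : ∃ w : F4, tr4 w ≠ 0 := by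
  classical
  by_contra! h
  have hs : (Finset.univ : Finset F4) ⊆ {0, 1} := by
    intro a _
    have h1 : a ^ 2 = a := by
      have := h a
      simp only [tr4] at this
      linear_combination this - a * F4_two
    simpa using idem_cases h1
  have h2 := Finset.card_le_card hs
  rw [Finset.card_univ, F4_card] at h2
  have h3 : ({0, 1} : Finset F4).card ≤ 2 := Finset.card_le_two
  omega

section
variable {n : ℕ}

lemma hIP_add_left (a b c : Fin n → F4) : hIP (a + b) c = hIP a c + hIP b c := by
  simp [hIP, add_mul, Finset.sum_add_distrib]

lemma hIP_smul_left (r : F4) (a c : Fin n → F4) : hIP (r • a) c = r * hIP a c := by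
  simp [hIP, Finset.mul_sum, mul_assoc]

lemma hIP_symm (a b : Fin n → F4) : hIP b a = hIP a b ^ 2 := by
  have : ∀ f : Fin n → F4, (∑ i, f i) ^ 2 = ∑ i, (f i) ^ 2 := fun f => sum_pow_char 2 _ _
  simp only [hIP, this]
  refine Finset.sum_congr rfl fun i _ => ?_
  linear_combination - a i ^ 2 * F4_pow4 (b i)

lemma hIP_add_right (a b c : Fin n → F4) : hIP a (b + c) = hIP a b + hIP a c := by
  rw [hIP_symm (b + c) a, hIP_add_left, hIP_symm b a, hIP_symm c a]
  linear_combination hIP b a * hIP c a * F4_two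

lemma hIP_smul_right (r : F4) (a c : Fin n → F4) : hIP a (r • c) = r ^ 2 * hIP a c := by
  rw [hIP_symm (r • c) a, hIP_smul_left, hIP_symm c a]; ring

lemma hIP_self_idem (a : Fin n → F4) : hIP a a ^ 2 = hIP a a := (hIP_symm a a).symm

lemma hIP_symm_zero {a b : Fin n → F4} (h : hIP a b = 0) : hIP b a = 0 := by
  rw [hIP_symm a b, h]; simp

lemma mem_hDual {C : Submodule F4 (Fin n → F4)} {x : Fin n → F4} :
    x ∈ hDual C ↔ ∀ c ∈ C, hIP x c = 0 := Iff.rfl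

/-- character -/
noncomputable def chi (v s : Fin n → F4) : ℤ := eps (tr4 (hIP v s))

lemma chi_symm (v s : Fin n → F4) : chi v s = chi s v := by
  simp only [chi]; rw [hIP_symm v s, tr4_sq]

lemma chi_add (v s s' : Fin n → F4) : chi v (s + s') = chi v s * chi v s' := by
  simp only [chi]; rw [hIP_add_right, tr4_add, eps_add (tr4_idem _) (tr4_idem _)]

lemma eps_self_add (v s : Fin n → F4) (hs : hIP s s = 0) :
    eps (hIP (v + s) (v + s)) = eps (hIP v v) * chi v s := by
  simp only [chi]
  rw [← eps_add (hIP_self_idem v) (tr4_idem _)]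
  congr 1
  rw [hIP_add_left, hIP_add_right, hIP_add_right, hs, hIP_symm v s, tr4]
  ring

noncomputable instance (S : Submodule F4 (Fin n → F4)) : Fintype S := Fintype.ofFinite S

lemma sum_chi_mem (S : Submodule F4 (Fin n → F4)) (v : Fin n → F4) (hv : v ∈ hDual S) :
    ∑ s : S, chi v s = Nat.card S := by
  have : ∀ s : S, chi v s = 1 := by
    intro s
    simp [chi, hv s s.2, tr4, eps_zero]
  simp [this]

lemma sum_chi_not_mem (S : Submodule F4 (Fin n → F4)) (v : Fin n → F4) (hv : v ∉ hDual S) :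
    ∑ s : S, chi v s = 0 := by
  rw [mem_hDual] at hv
  push Not at hv
  obtain ⟨s, hs, hb⟩ := hv
  obtain ⟨w, hw⟩ := exists_tr4
  set c : F4 := (w / hIP v s) ^ 2
  have h1 : hIP v (c • s) = w := by
    rw [hIP_smul_right]
    have : c ^ 2 = w / hIP v s := by
      rw [← F4_pow4 (w / hIP v s)]; simp only [c]; ring
    rw [this]; field_simp
  let s0 : S := ⟨c • s, S.smul_mem c hs⟩
  have h2 : chi v s0 = -1 := by
    simp only [chi, s0, h1]; exact eps_ne hw
  have h3 : ∑ s : S, chi v s = ∑ s : S, chi v ((s + s0 : S) : Fin n → F4) :=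
    (Fintype.sum_equiv (Equiv.addRight s0) _ _ (fun _ => rfl)).symm
  have h4 : ∑ s : S, chi v ((s + s0 : S) : Fin n → F4) = - ∑ s : S, chi v s := by
    rw [← Finset.sum_neg_distrib]
    refine Finset.sum_congr rfl fun s _ => ?_
    rw [Submodule.coe_add, chi_add, h2]; ring
  linarith

lemma hDual_top : hDual (⊤ : Submodule F4 (Fin n → F4)) = ⊥ := by
  classical
  rw [eq_bot_iff]
  intro v hv
  rw [Submodule.mem_bot]
  funext i
  have := hv (Pi.single i 1) trivial
  simpa [hIP, Pi.single_apply] using this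

lemma sum_chi_univ_zero (s : Fin n → F4) (hs : s ≠ 0) : ∑ v : Fin n → F4, chi v s = 0 := by
  have h := sum_chi_not_mem ⊤ s (by rw [hDual_top]; simpa using hs)
  rw [← h]
  symm
  refine Fintype.sum_equiv (Submodule.topEquiv (R := F4) (M := Fin n → F4)).toEquiv _ _ ?_
  intro v
  exact chi_symm _ _

lemma card_V : Nat.card (Fin n → F4) = 4 ^ n := by
  rw [Nat.card_eq_fintype_card, Fintype.card_fun, F4_card]; simp

lemma card_mul_card_hDual (S : Submodule F4 (Fin n → F4)) :
    Nat.card S * Nat.card (hDual S) = 4 ^ n := by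
  classical
  have h1 : ∑ v : Fin n → F4, ∑ s : S, chi v s = (Nat.card S * Nat.card (hDual S) : ℤ) := by
    have : ∀ v : Fin n → F4, ∑ s : S, chi v s = if v ∈ hDual S then (Nat.card S : ℤ) else 0 := by
      intro v
      split_ifs with h
      · exact sum_chi_mem S v h
      · exact sum_chi_not_mem S v h
    simp only [this]
    rw [← Finset.sum_filter, Finset.sum_const, Nat.card_eq_fintype_card (α := hDual S),
      Fintype.card_subtype]
    simp [mul_comm]
  rw [Finset.sum_comm] at h1
  have h2 : ∀ s : S, ∑ v : Fin n → F4, chi v s = if s = 0 then (4 : ℤ) ^ n else 0 := by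
    intro s
    split_ifs with h
    · subst h
      have : ∀ v : Fin n → F4, chi v 0 = 1 := by
        intro v; simp [chi, hIP, tr4, eps]
      have hc := card_V (n := n)
      rw [Nat.card_eq_fintype_card] at hc
      simp only [Submodule.coe_zero, this, Finset.sum_const, Finset.card_univ, hc]
      simp
    · exact sum_chi_univ_zero _ (by simpa using h)
  simp only [h2] at h1
  rw [Finset.sum_ite_eq' Finset.univ (0 : S)] at h1
  simp only [Finset.mem_univ, if_true] at h1
  exact_mod_cast h1.symm

lemma cube_idem (a : F4) : (a ^ 3) ^ 2 = a ^ 3 := by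
  linear_combination a ^ 2 * F4_pow4 a

lemma eps_sum {ι : Type*} (s : Finset ι) (f : ι → F4) :
    eps (∑ i ∈ s, f i ^ 3) = ∏ i ∈ s, eps (f i ^ 3) ∧
      (∑ i ∈ s, f i ^ 3) ^ 2 = ∑ i ∈ s, f i ^ 3 := by
  classical
  induction s using Finset.induction_on with
  | empty => simp [eps]
  | insert a s ha ih =>
    rw [Finset.sum_insert ha, Finset.prod_insert ha]
    constructor
    · rw [eps_add (cube_idem _) ih.2, ih.1]
    · linear_combination cube_idem (f a) + ih.2 + f a ^ 3 * (∑ i ∈ s, f i ^ 3) * F4_two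

lemma hIP_self (v : Fin n → F4) : hIP v v = ∑ i, v i ^ 3 :=
  Finset.sum_congr rfl fun i _ => by ring

lemma sum_eps_cube : ∑ a : F4, eps (a ^ 3) = -2 := by
  classical
  have h : ∀ a : F4, eps (a ^ 3) = if a = 0 then 1 else -1 := by
    intro a; simp [eps]
  simp only [h]
  rw [← Finset.add_sum_erase _ _ (Finset.mem_univ (0 : F4)),
    Finset.sum_congr rfl (g := fun _ => (-1 : ℤ))
      (fun a ha => if_neg (Finset.ne_of_mem_erase ha))]
  simp [Finset.card_erase_of_mem, F4_card]

lemma sum_eps_univ (hn : Even n) : ∑ v : Fin n → F4, eps (hIP v v) = 2 ^ n := by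
  classical
  have h : ∀ v : Fin n → F4, eps (hIP v v) = ∏ i, eps (v i ^ 3) := by
    intro v; rw [hIP_self]; exact (eps_sum _ _).1
  simp only [h]
  have := Finset.prod_univ_sum (fun _ : Fin n => (Finset.univ : Finset F4))
    (fun _ a => eps (a ^ 3))
  rw [Fintype.piFinset_univ] at this
  rw [← this]
  simp [sum_eps_cube, hn.neg_pow]

lemma sum_eps_hDual (hn : Even n) (S : Submodule F4 (Fin n → F4)) (hS : S ≤ hDual S) :
    ∑ v : hDual S, eps (hIP v.1 v.1) = 2 ^ n := by
  classical
  have h1 : ∑ s : S, ∑ v : Fin n → F4, eps (hIP v v) * chi v s = Nat.card S * 2 ^ n := by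
    have : ∀ s : S, ∑ v : Fin n → F4, eps (hIP v v) * chi v s = 2 ^ n := by
      intro s
      rw [← sum_eps_univ hn]
      refine Fintype.sum_equiv (Equiv.addRight (s : Fin n → F4)) _ _ ?_
      intro v
      exact (eps_self_add v s (hS s.2 s s.2)).symm
    simp [this]
  rw [Finset.sum_comm] at h1
  have h2 : ∀ v : Fin n → F4, ∑ s : S, eps (hIP v v) * chi v s =
      if v ∈ hDual S then Nat.card S * eps (hIP v v) else 0 := by
    intro v
    rw [← Finset.mul_sum]
    split_ifs with h
    · rw [sum_chi_mem S v h]; ring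
    · rw [sum_chi_not_mem S v h]; ring
  simp only [h2] at h1
  rw [← Finset.sum_filter, ← Finset.mul_sum] at h1
  have hpos : (Nat.card S : ℤ) ≠ 0 := by
    exact_mod_cast Nat.card_pos.ne'
  have h3 := mul_left_cancel₀ hpos h1
  rw [← h3]
  symm
  exact Finset.sum_subtype _ (by simp) _

open Classical in
/-- isotropic vectors in the dual -/
noncomputable def isoF (S : Submodule F4 (Fin n → F4)) : Finset (Fin n → F4) :=
  Finset.univ.filter fun v => v ∈ hDual S ∧ hIP v v = 0

lemma card_isoF (hn : Even n) (S : Submodule F4 (Fin n → F4)) (hS : S ≤ hDual S) :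
    2 * (isoF S).card = Nat.card (hDual S) + 2 ^ n := by
  classical
  have h := sum_eps_hDual hn S hS
  have h1 : ∀ v : hDual S, eps (hIP v.1 v.1) = 2 * (if hIP v.1 v.1 = 0 then 1 else 0) - 1 := by
    intro v; unfold eps; split_ifs <;> norm_num
  simp only [h1] at h
  rw [Finset.sum_sub_distrib, ← Finset.mul_sum] at h
  have h2 : ∑ v : hDual S, (if hIP v.1 v.1 = 0 then (1 : ℤ) else 0) = (isoF S).card := by
    rw [isoF, Finset.card_filter]
    push_cast
    rw [← Finset.sum_subtype (Finset.univ.filter fun v => v ∈ hDual S) (by simp)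
      (fun v => if hIP v v = 0 then (1 : ℤ) else 0), Finset.sum_filter]
    refine Finset.sum_congr rfl fun v _ => ?_
    by_cases a : v ∈ hDual S <;> simp [a]
  rw [h2] at h
  simp at h
  zify
  simp
  linarith

lemma eq_of_le_of_card {S T : Submodule F4 (Fin n → F4)} (h : S ≤ T)
    (hc : Nat.card T ≤ Nat.card S) : S = T := by
  apply SetLike.coe_injective
  exact Set.eq_of_subset_of_ncard_le h hc (Set.toFinite _)

lemma card_lag {C : Submodule F4 (Fin n → F4)} (h : C = hDual C) : Nat.card C = 2 ^ n := by
  have h1 := card_mul_card_hDual C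
  rw [← h] at h1
  have : Nat.card C ^ 2 = (2 ^ n) ^ 2 := by
    rw [sq, h1, ← pow_mul, mul_comm n 2, pow_mul]; norm_num
  exact Nat.pow_left_injective (n := 2) (by norm_num) this

lemma lag_of_card {C : Submodule F4 (Fin n → F4)} (h : C ≤ hDual C) (hc : Nat.card C = 2 ^ n) :
    C = hDual C := by
  refine eq_of_le_of_card h ?_
  have h1 := card_mul_card_hDual C
  rw [hc, show (4 : ℕ) = 2 * 2 by norm_num, mul_pow] at h1
  rw [hc]
  exact (Nat.eq_of_mul_eq_mul_left (by positivity) h1).le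

lemma card_span {x : Fin n → F4} (hx : x ≠ 0) : Nat.card (F4 ∙ x) = 4 := by
  rw [Nat.card_eq_fintype_card, Module.card_eq_pow_finrank (K := F4), finrank_span_singleton hx,
    F4_card]
  rfl

lemma card_sup {S : Submodule F4 (Fin n → F4)} {x : Fin n → F4} (hx : x ∉ S) :
    Nat.card (S ⊔ F4 ∙ x : Submodule F4 (Fin n → F4)) = 4 * Nat.card S := by
  have hx0 : x ≠ 0 := by rintro rfl; exact hx S.zero_mem
  have h := Submodule.finrank_sup_add_finrank_inf_eq S (F4 ∙ x)
  have hd : S ⊓ (F4 ∙ x) = ⊥ := by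
    rw [← disjoint_iff]
    exact (Submodule.disjoint_span_singleton' hx0).2 hx
  rw [hd, finrank_bot, finrank_span_singleton hx0, add_zero] at h
  rw [Nat.card_eq_fintype_card, Nat.card_eq_fintype_card, Module.card_eq_pow_finrank (K := F4), h,
    Module.card_eq_pow_finrank (K := F4) (V := S), F4_card, pow_succ, mul_comm]

lemma sup_iso {S : Submodule F4 (Fin n → F4)} (hS : S ≤ hDual S) {x : Fin n → F4}
    (hx : x ∈ hDual S) (hxx : hIP x x = 0) :
    (S ⊔ F4 ∙ x) ≤ hDual (S ⊔ F4 ∙ x) := by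
  intro a ha c hc
  obtain ⟨s, hs, y, hy, rfl⟩ := Submodule.mem_sup.1 ha
  obtain ⟨s', hs', y', hy', rfl⟩ := Submodule.mem_sup.1 hc
  obtain ⟨r, rfl⟩ := Submodule.mem_span_singleton.1 hy
  obtain ⟨r', rfl⟩ := Submodule.mem_span_singleton.1 hy'
  rw [hIP_add_left, hIP_add_right, hIP_add_right, hIP_smul_left, hIP_smul_left, hIP_smul_right,
    hIP_smul_right, hxx, hx s' hs', hS hs s' hs', hIP_symm_zero (hx s hs)]
  simp

noncomputable instance : Fintype (Submodule F4 (Fin n → F4)) := Fintype.ofFinite _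

open Classical in
/-- self-dual codes containing `S` -/
noncomputable def lagF (S : Submodule F4 (Fin n → F4)) : Finset (Submodule F4 (Fin n → F4)) :=
  Finset.univ.filter fun C => C = hDual C ∧ S ≤ C

lemma card_lagF (hn : Even n) (j : ℕ) : ∀ S : Submodule F4 (Fin n → F4), S ≤ hDual S →
    Nat.card S * 4 ^ j = 2 ^ n →
    (lagF S).card = ∏ i ∈ Finset.range j, (2 ^ (2 * i + 1) + 1) := by
  classical
  induction j with
  | zero =>
    intro S hS hc
    rw [pow_zero, mul_one] at hc
    have : lagF S = {S} := by
      ext C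
      simp only [lagF, Finset.mem_filter, Finset.mem_univ, true_and, Finset.mem_singleton]
      constructor
      · rintro ⟨h1, h2⟩
        exact (eq_of_le_of_card h2 (by rw [hc, card_lag h1])).symm
      · rintro rfl
        exact ⟨lag_of_card hS hc, le_rfl⟩
    simp [this]
  | succ j ih =>
    intro S hS hc
    set X : Finset (Fin n → F4) := (isoF S).filter fun x => x ∉ S with hX
    have key := Finset.sum_card_bipartiteAbove_eq_sum_card_bipartiteBelow
      (s := lagF S) (t := X) (fun C x => x ∈ C)
    have hSI : ∀ x ∈ S, x ∈ isoF S := by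
      intro x hx
      simp only [isoF, Finset.mem_filter, Finset.mem_univ, true_and]
      exact ⟨hS hx, hS hx x hx⟩
    have hScard : Nat.card S = (Finset.univ.filter fun x : Fin n → F4 => x ∈ S).card := by
      rw [Nat.card_eq_fintype_card, Fintype.card_subtype]
    have hXcard : X.card + Nat.card S = (isoF S).card := by
      rw [hX, hScard, ← Finset.card_filter_add_card_filter_not (s := isoF S) (fun x => x ∈ S),
        add_comm]
      congr 2
      ext x
      simp only [Finset.mem_filter, Finset.mem_univ, true_and]
      exact ⟨fun h => ⟨hSI x h, h⟩, fun h => h.2⟩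
    have hA : ∀ C ∈ lagF S, (Finset.bipartiteAbove (fun C x => x ∈ C) X C).card + Nat.card S
        = 2 ^ n := by
      intro C hC
      simp only [lagF, Finset.mem_filter, Finset.mem_univ, true_and] at hC
      rw [← card_lag hC.1, Nat.card_eq_fintype_card (α := C), Fintype.card_subtype, hScard,
        ← Finset.card_union_of_disjoint]
      · congr 1
        ext x
        simp only [Finset.bipartiteAbove, hX, isoF, Finset.mem_union, Finset.mem_filter,
          Finset.mem_univ, true_and]
        constructor
        · rintro (h | h)
          · exact h.2
          · exact hC.2 h
        · intro h
          by_cases hxS : x ∈ S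
          · exact Or.inr hxS
          · have hd : x ∈ hDual C := hC.1 ▸ h
            exact Or.inl ⟨⟨⟨fun c hc => hd c (hC.2 hc), hd x h⟩, hxS⟩, h⟩
      · rw [Finset.disjoint_left]
        intro x h1 h2
        simp only [Finset.bipartiteAbove, hX, Finset.mem_filter, Finset.mem_univ, true_and]
          at h1 h2
        exact h1.1.2 h2
    have hB : ∀ x ∈ X, (Finset.bipartiteBelow (fun C x => x ∈ C) (lagF S) x).card =
        ∏ i ∈ Finset.range j, (2 ^ (2 * i + 1) + 1) := by
      intro x hx
      simp only [hX, isoF, Finset.mem_filter, Finset.mem_univ, true_and] at hx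
      rw [← ih (S ⊔ F4 ∙ x) (sup_iso hS hx.1.1 hx.1.2) (by rw [card_sup hx.2, ← hc]; ring)]
      congr 1
      ext C
      simp only [Finset.bipartiteBelow, lagF, Finset.mem_filter, Finset.mem_univ, true_and,
        sup_le_iff, Submodule.span_singleton_le_iff_mem, and_assoc]
    rw [Finset.sum_congr rfl hB, Finset.sum_const, smul_eq_mul] at key
    set P := ∏ i ∈ Finset.range j, (2 ^ (2 * i + 1) + 1) with hP
    have hsum : ∑ C ∈ lagF S, (Finset.bipartiteAbove (fun C x => x ∈ C) X C).card
        + (lagF S).card * Nat.card S = (lagF S).card * 2 ^ n := by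
      rw [← smul_eq_mul, ← Finset.sum_const, ← Finset.sum_add_distrib, Finset.sum_congr rfl hA,
        Finset.sum_const, smul_eq_mul]
    rw [key] at hsum
    have hI := card_isoF hn S hS
    have hD := card_mul_card_hDual S
    have hpos : 0 < Nat.card S := Nat.card_pos
    rw [Finset.prod_range_succ, ← hP]
    have h4 : (4 : ℕ) ^ n = 2 ^ n * 2 ^ n := by rw [← mul_pow]; norm_num
    have hD' : Nat.card (hDual S) = Nat.card S * 4 ^ (j + 1) * 4 ^ (j + 1) := by
      apply Nat.eq_of_mul_eq_mul_left hpos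
      rw [hD, h4, ← hc]; ring
    have h5 : (4 : ℕ) ^ (j + 1) = 2 * 2 ^ (2 * j + 1) := by
      rw [show (4 : ℕ) = 2 ^ 2 by norm_num, ← pow_mul]; ring
    rw [← hXcard, hD', ← hc, h5] at hI
    rw [← hc, h5] at hsum
    have hh : 2 ≤ (2 : ℕ) ^ (2 * j + 1) := by
      calc 2 = 2 ^ 1 := rfl
        _ ≤ _ := Nat.pow_le_pow_right (by norm_num) (by omega)
    generalize (2 : ℕ) ^ (2 * j + 1) = h at *
    generalize Nat.card S = s at *
    generalize X.card = xc at *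
    generalize (lagF S).card = L at *
    clear_value P
    clear hP ih key hA hB hSI hScard hXcard hD hD' h4 h5 hc
    zify at *
    have e1 : (xc : ℤ) = s * (2 * h - 1) * (h + 1) := by linarith
    have e2 : (s * (2 * h - 1) : ℤ) * L = s * (2 * h - 1) * (P * (h + 1)) := by
      rw [e1] at hsum; linarith
    refine mul_left_cancel₀ ?_ e2
    have : (0 : ℤ) < s * (2 * h - 1) := by
      apply mul_pos hpos; linarith
    exact this.ne'

lemma hIP_self_of_even_wt (x : Fin n → F4) (h : Even (wt x)) : hIP x x = 0 := by
  classical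
  have h1 : ∀ a : F4, a ^ 3 = if a ≠ 0 then 1 else 0 := by
    intro a
    split_ifs with ha
    · apply mul_left_cancel₀ ha
      linear_combination F4_pow4 a
    · push Not at ha
      simp [ha]
  rw [hIP_self]
  simp only [h1]
  rw [Finset.sum_boole]
  rw [wt, Nat.card_eq_fintype_card, Fintype.card_subtype] at h
  obtain ⟨k, hk⟩ := h
  rw [hk]
  push_cast
  exact F4_add_self _

end

/-- For even `n > 0` and a nonzero vector `x` of even weight, the number of
Hermitian self-dual codes of length `n` containing `x` is `∏_{i=0}^{n/2-2} (2^{2i+1}+1)`. -/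
theorem stmt6 {n : ℕ} (hn : 0 < n) (hne : Even n) (x : Fin n → F4) (hx : x ≠ 0)
    (hwt : Even (wt x)) :
    Nat.card {C : Submodule F4 (Fin n → F4) // C = hDual C ∧ x ∈ C} =
      ∏ i ∈ Finset.range (n / 2 - 1), (2 ^ (2 * i + 1) + 1) := by
  classical
  have hxx := hIP_self_of_even_wt x hwt
  have hS : (F4 ∙ x) ≤ hDual (F4 ∙ x) := by
    have := sup_iso (S := ⊥) (x := x) bot_le
      (by intro c hc; rw [(Submodule.mem_bot F4).1 hc]; simp [hIP]) hxx
    simpa using this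
  obtain ⟨m, rfl⟩ := hne
  have := card_lagF ⟨m, rfl⟩ ((m + m) / 2 - 1) (F4 ∙ x) hS (by
    rw [card_span hx, ← pow_succ', show (m + m) / 2 - 1 + 1 = m by omega,
      show (4 : ℕ) = 2 * 2 by norm_num, mul_pow, pow_add])
  rw [← this, Nat.card_eq_fintype_card, Fintype.card_subtype, lagF]
  simp only [Submodule.span_singleton_le_iff_mem]
end

section
/- The minimum weight d of a Hermitian self-dual code of length n over F_4 satisfies d ≤ 2⌊n/6⌋ + 2. -/
namespace MOSW

open Polynomial

/-! ### Power series part -/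

section PS

/-- `f = 1 + 3t`. -/
noncomputable def pf : PowerSeries ℝ := 1 + 3 * PowerSeries.X

/-- `e = 1 / (1 - t)`. -/
noncomputable def pe : PowerSeries ℝ := PowerSeries.mk 1

lemma pe_mul : pe * (1 - PowerSeries.X) = 1 := PowerSeries.mk_one_mul_one_sub_eq_one ℝ

lemma d_pf : PowerSeries.derivative ℝ pf = 3 := by
  have h : PowerSeries.derivative ℝ pf = 3 := by
    have h3 : (3 : PowerSeries ℝ) = PowerSeries.C (3 : ℝ) := (map_ofNat PowerSeries.C 3).symm
    rw [pf, h3, map_add, Derivation.leibniz, PowerSeries.derivative_C]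
    simp
  exact h

lemma d_pe : PowerSeries.derivative ℝ pe = pe ^ 2 := by
  have h := congrArg (PowerSeries.derivative ℝ) pe_mul
  rw [Derivation.leibniz] at h
  simp only [map_sub, Derivation.map_one_eq_zero, PowerSeries.derivative_X,
    smul_eq_mul] at h
  have h2 := pe_mul
  linear_combination pe * h - PowerSeries.derivative ℝ pe * h2

lemma coeff_euler (s : ℕ) (h : PowerSeries ℝ) :
    PowerSeries.coeff s ((s : PowerSeries ℝ) * h - PowerSeries.X * PowerSeries.derivative ℝ h) = 0 := by
  have hs : (s : PowerSeries ℝ) = PowerSeries.C (s : ℝ) := by simp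
  rw [hs, map_sub, PowerSeries.coeff_C_mul]
  cases s with
  | zero => simp
  | succ s =>
    rw [PowerSeries.coeff_succ_X_mul, PowerSeries.coeff_derivative]
    push_cast; ring

lemma key_coeff (s k p : ℕ) (hp : p + 1 + k = 3 * s) :
    (s : ℝ) * PowerSeries.coeff s ((1 - 9 * PowerSeries.X) * pf ^ p * pe ^ (2 * s + 1)) =
      - (3 * k : ℝ) * PowerSeries.coeff s (PowerSeries.X * (pf ^ p * pe ^ (2 * s))) := by
  have h := coeff_euler s (pf ^ (p + 1) * pe ^ (2 * s))
  have e1 : (s : PowerSeries ℝ) * (pf ^ (p + 1) * pe ^ (2 * s)) - PowerSeries.X *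
      PowerSeries.derivative ℝ (pf ^ (p + 1) * pe ^ (2 * s)) =
      PowerSeries.C (s : ℝ) * ((1 - 9 * PowerSeries.X) * pf ^ p * pe ^ (2 * s + 1)) +
      PowerSeries.C (3 * k : ℝ) * (PowerSeries.X * (pf ^ p * pe ^ (2 * s))) := by
    have hd : PowerSeries.derivative ℝ pf = 3 := d_pf
    have hpk : (p : PowerSeries ℝ) + 1 + k = 3 * s := by
      have := congrArg (Nat.cast : ℕ → PowerSeries ℝ) hp
      push_cast at this
      exact this
    rw [Derivation.leibniz, Derivation.leibniz_pow, Derivation.leibniz_pow, hd, d_pe]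
    simp only [smul_eq_mul, nsmul_eq_mul, map_mul, map_natCast, map_ofNat]
    have e2 : ((2 * s : ℕ) : PowerSeries ℝ) * (pe ^ (2 * s - 1) * pe ^ 2) =
        2 * s * pe ^ (2 * s + 1) := by
      cases s with
      | zero => simp
      | succ s =>
        rw [← pow_add]; push_cast
        congr 2
    rw [e2, Nat.add_sub_cancel]
    have h1 := pe_mul
    have hpp : (p : PowerSeries ℝ) = 3 * s - 1 - k := by linear_combination hpk
    push_cast
    rw [hpp]
    have hfd : pf = 1 + 3 * PowerSeries.X := rfl
    rw [pow_succ pf, pow_succ pe]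
    generalize pf ^ p = A
    generalize pe ^ (2 * s) = B
    rw [hfd]
    linear_combination (-(s : PowerSeries ℝ) * A * B * (1 + 3 * PowerSeries.X)
      + 9 * s * PowerSeries.X * A * B) * h1
  rw [e1, map_add, PowerSeries.coeff_C_mul, PowerSeries.coeff_C_mul] at h
  linarith

/-- Nonnegative coefficients. -/
def NN (h : PowerSeries ℝ) : Prop := ∀ i, 0 ≤ PowerSeries.coeff i h

lemma NN.mul {a b : PowerSeries ℝ} (ha : NN a) (hb : NN b) : NN (a * b) := fun i => by
  rw [PowerSeries.coeff_mul]
  exact Finset.sum_nonneg fun x _ => mul_nonneg (ha _) (hb _)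

lemma NN.pow {a : PowerSeries ℝ} (ha : NN a) (k : ℕ) : NN (a ^ k) := by
  induction k with
  | zero => intro i; rw [pow_zero, PowerSeries.coeff_one]; split_ifs <;> norm_num
  | succ k ih => rw [pow_succ]; exact ih.mul ha

lemma NN_pf : NN pf := fun i => by
  have h3 : (3 : PowerSeries ℝ) = PowerSeries.C (3 : ℝ) := (map_ofNat PowerSeries.C 3).symm
  rw [pf, h3, map_add, PowerSeries.coeff_C_mul, PowerSeries.coeff_one, PowerSeries.coeff_X]
  split_ifs <;> norm_num

lemma NN_pe : NN pe := fun i => by simp [pe]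

/-- all coefficients positive -/
lemma pos_of (a : PowerSeries ℝ) (ha : NN a) (h0 : 0 < PowerSeries.coeff 0 a) (i : ℕ) :
    0 < PowerSeries.coeff i (a * pe) := by
  rw [PowerSeries.coeff_mul]
  refine Finset.sum_pos' (fun x _ => mul_nonneg (ha _) (NN_pe _)) ⟨(0, i), by simp, ?_⟩
  simpa [pe] using h0

lemma key_neg (s k p : ℕ) (hs : 0 < s) (hk : 0 < k) (hp : p + 1 + k = 3 * s) :
    PowerSeries.coeff s ((1 - 9 * PowerSeries.X) * pf ^ p * pe ^ (2 * s + 1)) ≠ 0 := by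
  intro h
  have h2 := key_coeff s k p hp
  rw [h] at h2
  obtain ⟨s, rfl⟩ : ∃ t, s = t + 1 := ⟨s - 1, by omega⟩
  rw [PowerSeries.coeff_succ_X_mul] at h2
  have h3 : 0 < PowerSeries.coeff s (pf ^ p * pe ^ (2 * (s + 1))) := by
    have : pf ^ p * pe ^ (2 * (s + 1)) = (pf ^ p * pe ^ (2 * s + 1)) * pe := by ring
    rw [this]
    refine pos_of _ ((NN_pf.pow _).mul (NN_pe.pow _)) ?_ s
    simp [pf, pe]
  have hk' : (0 : ℝ) < 3 * k := by positivity
  nlinarith [mul_pos hk' h3]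

lemma key_zero (s p : ℕ) (hs : 0 < s) (hp : p + 1 = 3 * s) :
    PowerSeries.coeff s ((1 - 9 * PowerSeries.X) * pf ^ p * pe ^ (2 * s + 1)) = 0 := by
  have h2 := key_coeff s 0 p hp
  have : (s : ℝ) ≠ 0 := by positivity
  simpa [this] using h2

lemma no_extremal (k : ℕ) (hk : 0 < k) (a : ℕ → ℝ) (V : ℝ[X])
    (hV : V = ∑ j ∈ Finset.range (k / 3 + 1), C (a j) * ((1 + 3 * X) ^ (k - 3 * j) * (X * (1 - X) ^ 2) ^ j))
    (h0 : V.coeff 0 = 1) (hz : ∀ i, 1 ≤ i → i ≤ k / 3 + 1 → V.coeff i = 0) : False := by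
  set m := k / 3 with hm
  have hkm : k ≤ 3 * m + 2 := by omega
  set G : PowerSeries ℝ := (1 - 9 * PowerSeries.X) * pf ^ (3 * m + 2 - k) * pe ^ (2 * (m + 1) + 1) with hG
  have hGne : PowerSeries.coeff (m + 1) G ≠ 0 :=
    key_neg (m + 1) k (3 * m + 2 - k) (by omega) hk (by omega)
  apply hGne
  have e1 : PowerSeries.coeff (m + 1) ((V : PowerSeries ℝ) * G) = PowerSeries.coeff (m + 1) G := by
    rw [PowerSeries.coeff_mul, Finset.sum_eq_single (0, m + 1)]
    · simp [h0]
    · rintro ⟨i, j⟩ hij hne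
      rw [Finset.HasAntidiagonal.mem_antidiagonal] at hij
      simp only at hij
      have : i ≠ 0 := by rintro rfl; apply hne; simp at hij; simp [hij]
      simp [hz i (by omega) (by omega)]
    · simp
  rw [← e1, hV]
  have e3 : ((∑ j ∈ Finset.range (m + 1), C (a j) * ((1 + 3 * X) ^ (k - 3 * j) * (X * (1 - X) ^ 2) ^ j) : ℝ[X]) : PowerSeries ℝ)
      = ∑ j ∈ Finset.range (m + 1), PowerSeries.C (a j) *
        (pf ^ (k - 3 * j) * (PowerSeries.X * (1 - PowerSeries.X) ^ 2) ^ j) := by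
    rw [← Polynomial.coeToPowerSeries.ringHom_apply, map_sum]
    refine Finset.sum_congr rfl fun j _ => ?_
    simp only [map_mul, map_pow, map_add, map_sub, map_one, map_ofNat]
    simp [pf]
  rw [e3, Finset.sum_mul, map_sum]
  refine Finset.sum_eq_zero fun j hj => ?_
  rw [Finset.mem_range] at hj
  obtain ⟨s, hs⟩ : ∃ s, m + 1 = s + j := ⟨m + 1 - j, by omega⟩
  have e4 : PowerSeries.C (a j) * (pf ^ (k - 3 * j) * (PowerSeries.X * (1 - PowerSeries.X) ^ 2) ^ j) * G
      = PowerSeries.C (a j) * (PowerSeries.X ^ j *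
        ((1 - 9 * PowerSeries.X) * pf ^ (3 * s - 1) * pe ^ (2 * s + 1))) := by
    have e5 : pe ^ (2 * (m + 1) + 1) = pe ^ (2 * s + 1) * (pe ^ 2) ^ j := by
      rw [← pow_mul, ← pow_add]; congr 1; omega
    have e6 : pf ^ (3 * s - 1) = pf ^ (k - 3 * j) * pf ^ (3 * m + 2 - k) := by
      rw [← pow_add]; congr 1; omega
    have e7 : ((1 - PowerSeries.X) ^ 2) ^ j * (pe ^ 2) ^ j = 1 := by
      rw [← mul_pow, ← mul_pow, mul_comm, pe_mul]; simp
    rw [hG, e5, e6, mul_pow]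
    linear_combination (PowerSeries.C (a j) * pf ^ (k - 3 * j) * PowerSeries.X ^ j *
      (1 - 9 * PowerSeries.X) * pf ^ (3 * m + 2 - k) * pe ^ (2 * s + 1)) * e7
  rw [e4, PowerSeries.coeff_C_mul, hs, PowerSeries.coeff_X_pow_mul, key_zero s _ (by omega) (by omega),
    mul_zero]

end PS

/-! ### Gleason-type theorem -/

lemma exists_R (P : ℝ[X]) (N : ℕ) (hP : P.natDegree ≤ N) :
    ∃ R : ℝ[X], ∀ y : ℝ, 1 < y → R.eval y = (1 + 3 * y) ^ (2 * N) * P.eval (((1 - y) / (1 + 3 * y)) ^ 2) := by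
  refine ⟨∑ i ∈ Finset.range (N + 1), C (P.coeff i) * ((1 - X) ^ (2 * i) * (1 + 3 * X) ^ (2 * (N - i))), ?_⟩
  intro y hy
  have h0 : 1 + 3 * y ≠ 0 := by positivity
  rw [Polynomial.eval_eq_sum_range' (Nat.lt_succ_of_le hP), Polynomial.eval_finsetSum, Finset.mul_sum]
  refine Finset.sum_congr rfl fun i hi => ?_
  rw [Finset.mem_range] at hi
  simp only [eval_mul, eval_C, eval_pow, eval_sub, eval_add, eval_one, eval_X, eval_ofNat]
  have : 2 * N = 2 * (N - i) + 2 * i := by omega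
  rw [this, pow_add, ← pow_mul, div_pow]
  field_simp

lemma gleason : ∀ (k : ℕ) (V : ℝ[X]), V.natDegree ≤ k →
    (∀ y : ℝ, 1 < y → (1 + 3 * y) ^ (2 * k) * V.eval (((1 - y) / (1 + 3 * y)) ^ 2) = 4 ^ k * V.eval (y ^ 2)) →
    ∃ a : ℕ → ℝ, V = ∑ j ∈ Finset.range (k / 3 + 1),
      C (a j) * ((1 + 3 * X) ^ (k - 3 * j) * (X * (1 - X) ^ 2) ^ j) := by
  intro k
  induction k using Nat.strong_induction_on with
  | _ k ih =>
  intro V hdeg hV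
  rcases Nat.eq_zero_or_pos k with rfl | hk
  · refine ⟨fun _ => V.coeff 0, ?_⟩
    simpa using Polynomial.eq_C_of_natDegree_le_zero hdeg
  have hd3 : ((1 + 3 * X : ℝ[X]) ^ k).natDegree ≤ k := by
    compute_degree
  set V0 : ℝ[X] := V - C (V.coeff 0) * (1 + 3 * X) ^ k with hV0
  have hdeg0 : V0.natDegree ≤ k := by
    refine (natDegree_sub_le _ _).trans (max_le hdeg ((natDegree_C_mul_le _ _).trans hd3))
  have hV0f : ∀ y : ℝ, 1 < y →
      (1 + 3 * y) ^ (2 * k) * V0.eval (((1 - y) / (1 + 3 * y)) ^ 2) = 4 ^ k * V0.eval (y ^ 2) := by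
    intro y hy
    have h0 : 1 + 3 * y ≠ 0 := by positivity
    simp only [hV0, eval_sub, eval_mul, eval_C, eval_pow, eval_add, eval_one, eval_X, eval_ofNat]
    rw [mul_sub, mul_sub, hV y hy]
    have : (1 + 3 * y) ^ (2 * k) * (1 + 3 * ((1 - y) / (1 + 3 * y)) ^ 2) ^ k = 4 ^ k * (1 + 3 * y ^ 2) ^ k := by
      rw [pow_mul, ← mul_pow, ← mul_pow]
      congr 1
      field_simp
      ring
    linear_combination (-V.coeff 0) * this
  have hc0 : V0.coeff 0 = 0 := by
    rw [coeff_zero_eq_eval_zero, hV0, coeff_zero_eq_eval_zero]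
    simp
  obtain ⟨V1, hV1⟩ := Polynomial.X_dvd_iff.2 hc0
  have hdeg1 : V1.natDegree ≤ k - 1 := by
    by_cases h : V1 = 0
    · simp [h]
    · rw [hV1, natDegree_X_mul h] at hdeg0; omega
  obtain ⟨R, hR⟩ := exists_R V1 (k - 1) hdeg1
  have hpoly : C (4 ^ k) * V0.comp (X ^ 2) = (1 - X) ^ 2 * R := by
    refine Polynomial.eq_of_infinite_eval_eq _ _ ((Set.Ioi_infinite (1 : ℝ)).mono ?_)
    intro y hy
    have hy : 1 < y := hy
    have h0 : 1 + 3 * y ≠ 0 := by positivity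
    simp only [Set.mem_ofPred_eq, eval_mul, eval_C, eval_comp, eval_pow, eval_X, eval_sub, eval_one]
    rw [← hV0f y hy, hR y hy, hV1]
    have : 2 * k = 2 * (k - 1) + 2 := by omega
    rw [this, pow_add, eval_mul, eval_X, div_pow]
    field_simp
  have h1 : V0.eval 1 = 0 := by
    have := congrArg (eval 1) hpoly
    simpa using this
  have h1' : (derivative V0).eval 1 = 0 := by
    have := congrArg (fun p => eval 1 (derivative p)) hpoly
    simpa [derivative_mul, derivative_comp, derivative_pow] using this
  obtain ⟨V2, hV2⟩ := Polynomial.dvd_iff_isRoot.2 h1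
  have h2 : V2.eval 1 = 0 := by
    rw [hV2] at h1'
    simpa [derivative_mul] using h1'
  obtain ⟨V3, hV3⟩ := Polynomial.dvd_iff_isRoot.2 h2
  have h3 : V3.eval 0 = 0 := by
    rw [hV2, hV3, coeff_zero_eq_eval_zero] at hc0
    simpa using hc0
  obtain ⟨Q, hQ⟩ := Polynomial.X_dvd_iff.2 (coeff_zero_eq_eval_zero V3 ▸ h3)
  have hVQ : V0 = (X * (1 - X) ^ 2) * Q := by
    rw [hV2, hV3, hQ, C_1]; ring
  have hgd : (X * (1 - X) ^ 2 : ℝ[X]).natDegree = 3 := by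
    compute_degree!
  have hVeq : V = C (V.coeff 0) * (1 + 3 * X) ^ k + (X * (1 - X) ^ 2) * Q := by
    rw [← hVQ, hV0]; ring
  have hgne : (X * (1 - X) ^ 2 : ℝ[X]) ≠ 0 := by
    intro h; rw [h] at hgd; simp at hgd
  by_cases hQ0 : Q = 0
  · refine ⟨fun j => if j = 0 then V.coeff 0 else 0, ?_⟩
    rw [Finset.sum_eq_single 0]
    · conv_lhs => rw [hVeq, hQ0]
      simp
    · intro j _ hj; simp [hj]
    · simp
  rw [hVQ, natDegree_mul hgne hQ0, hgd] at hdeg0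
  obtain ⟨a, ha⟩ := ih (k - 3) (by omega) Q (by omega) (by
    intro y hy
    have h0 : 1 + 3 * y ≠ 0 := by positivity
    have h := hV0f y hy
    rw [hVQ] at h
    simp only [eval_mul, eval_X, eval_pow, eval_sub, eval_one] at h
    have e1 : 2 * k = 2 * (k - 3) + 6 := by omega
    have e2 : (4 : ℝ) ^ k = 4 ^ (k - 3) * 64 := by
      have : k = (k - 3) + 3 := by omega
      conv_lhs => rw [this, pow_add]
      norm_num
    rw [e1, pow_add, e2] at h
    have e3 : (1 + 3 * y) ^ 6 * (((1 - y) / (1 + 3 * y)) ^ 2 * (1 - ((1 - y) / (1 + 3 * y)) ^ 2) ^ 2)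
        = 64 * (y ^ 2 * (1 - y ^ 2) ^ 2) := by
      field_simp
      ring
    have e4 : 64 * (y ^ 2 * (1 - y ^ 2) ^ 2) ≠ 0 := by
      have : 1 - y ^ 2 ≠ 0 := by nlinarith
      positivity
    apply mul_left_cancel₀ e4
    linear_combination h - (1 + 3 * y) ^ (2 * (k - 3)) * eval (((1 - y) / (1 + 3 * y)) ^ 2) Q * e3)
  refine ⟨fun j => if j = 0 then V.coeff 0 else a (j - 1), ?_⟩
  have hk3 : k / 3 = (k - 3) / 3 + 1 := by omega
  rw [Finset.sum_range_succ', hk3]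
  conv_lhs => rw [hVeq, ha]
  rw [add_comm, Finset.mul_sum]
  refine congrArg₂ (· + ·) ?_ ?_
  · refine Finset.sum_congr rfl fun j _ => ?_
    have : k - 3 * (j + 1) = k - 3 - 3 * j := by omega
    simp only [this, Nat.add_sub_cancel, if_neg (Nat.succ_ne_zero j)]
    ring
  · simp

end MOSW

namespace MOSW2

noncomputable instance : Fintype F4 := Fintype.ofFinite _

lemma cardF4 : Fintype.card F4 = 4 := by
  rw [← Nat.card_eq_fintype_card, GaloisField.card 2 2 (by norm_num)]; norm_num

lemma cube (a : F4) (ha : a ≠ 0) : a ^ 3 = 1 := by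
  have := FiniteField.pow_card_sub_one_eq_one a ha
  rwa [cardF4] at this

lemma four (a : F4) : a ^ 4 = a := by
  have := FiniteField.pow_card a
  rwa [cardF4] at this

lemma exists_char : ∃ ψ : AddChar F4 ℝ, ψ ≠ 1 := by
  classical
  refine ⟨(AddChar.zmodChar 2 (by norm_num : (-1 : ℝ) ^ 2 = 1)).compAddMonoidHom
    (Algebra.trace (ZMod 2) F4).toAddMonoidHom, ?_⟩
  obtain ⟨x, hx⟩ := Algebra.trace_surjective (ZMod 2) F4 1
  intro h
  have h2 := DFunLike.congr_fun h x
  have hx' : (Algebra.trace (ZMod 2) F4).toAddMonoidHom x = 1 := hx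
  rw [AddChar.compAddMonoidHom_apply, hx', AddChar.zmodChar_apply] at h2
  rw [AddChar.one_apply] at h2
  have : (1 : ZMod 2).val = 1 := rfl
  rw [this] at h2
  norm_num at h2

open Classical in
lemma wt_eq {n : ℕ} (x : Fin n → F4) : wt x = (Finset.univ.filter fun i => x i ≠ 0).card := by
  rw [wt, Nat.card_eq_fintype_card, Fintype.card_subtype]

lemma wt_le {n : ℕ} (x : Fin n → F4) : wt x ≤ n := by
  classical
  rw [wt_eq]
  exact (Finset.card_le_univ _).trans (by simp)

open Classical in
lemma pow_wt {n : ℕ} (x : Fin n → F4) (y : ℝ) : y ^ wt x = ∏ i, if x i = 0 then 1 else y := by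
  rw [wt_eq, Finset.prod_ite]
  simp

lemma wt_zero {n : ℕ} : wt (0 : Fin n → F4) = 0 := by
  classical
  rw [wt_eq]; simp

lemma wt_pos {n : ℕ} (x : Fin n → F4) (hx : x ≠ 0) : wt x ≠ 0 := by
  classical
  rw [wt_eq]
  intro h
  apply hx
  funext i
  by_contra hi
  rw [Finset.card_eq_zero] at h
  have : i ∈ Finset.univ.filter fun i => x i ≠ 0 := by simpa using hi
  rw [h] at this
  simp at this

lemma hIP_self {n : ℕ} (x : Fin n → F4) : hIP x x = (wt x : F4) := by
  classical
  rw [wt_eq, hIP, Finset.card_filter]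
  push_cast
  refine Finset.sum_congr rfl fun i _ => ?_
  split_ifs with h
  · rw [← cube _ h]; ring
  · push Not at h; simp [h]

lemma wt_even {n : ℕ} (x : Fin n → F4) (h : hIP x x = 0) : Even (wt x) := by
  rw [hIP_self, CharP.cast_eq_zero_iff F4 2] at h
  exact even_iff_two_dvd.2 h

lemma hIP_add_right {n : ℕ} (x a b : Fin n → F4) : hIP x (a + b) = hIP x a + hIP x b := by
  simp only [hIP, Pi.add_apply]
  rw [← Finset.sum_add_distrib]
  refine Finset.sum_congr rfl fun i _ => ?_
  rw [add_pow_char, mul_add]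

lemma hIP_smul_right {n : ℕ} (x a : Fin n → F4) (r : F4) : hIP x (r • a) = r ^ 2 * hIP x a := by
  simp only [hIP, Pi.smul_apply, smul_eq_mul, Finset.mul_sum]
  refine Finset.sum_congr rfl fun i _ => ?_
  ring

open Classical in
lemma local_sum (ψ : AddChar F4 ℝ) (hψ : ψ ≠ 1) (b : F4) (y : ℝ) :
    ∑ a : F4, ψ (a * b ^ 2) * (if a = 0 then 1 else y) = if b = 0 then 1 + 3 * y else 1 - y := by
  have e : ∀ a : F4, ψ (a * b ^ 2) * (if a = 0 then 1 else y) =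
      ψ (a * b ^ 2) * y + (if a = 0 then (1 - y) else 0) := by
    intro a
    split_ifs with h
    · simp [h]
    · simp
  rw [Finset.sum_congr rfl fun a _ => e a, Finset.sum_add_distrib, ← Finset.sum_mul]
  simp only [Finset.sum_ite_eq', Finset.mem_univ, if_true]
  split_ifs with h
  · have : (Finset.univ : Finset F4).card = 4 := cardF4
    simp [h, this]; ring
  · have : ∑ a : F4, ψ (a * b ^ 2) = ∑ a : F4, ψ a :=
      Equiv.sum_comp (Equiv.mulRight₀ (b ^ 2) (pow_ne_zero 2 h)) (fun a => ψ a)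
    rw [this, AddChar.sum_eq_zero_of_ne_one hψ]; ring

lemma map_sum_char {ι : Type*} (ψ : AddChar F4 ℝ) (s : Finset ι) (f : ι → F4) :
    ψ (∑ i ∈ s, f i) = ∏ i ∈ s, ψ (f i) := by
  classical
  induction s using Finset.induction_on with
  | empty => simp
  | insert a s ha ih =>
    rw [Finset.sum_insert ha, Finset.prod_insert ha, AddChar.map_add_eq_mul, ih]

open Classical in
lemma full_sum {n : ℕ} (ψ : AddChar F4 ℝ) (hψ : ψ ≠ 1) (c : Fin n → F4) (y : ℝ) :
    ∑ v : Fin n → F4, ψ (hIP v c) * y ^ wt v = (1 - y) ^ wt c * (1 + 3 * y) ^ (n - wt c) := by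
  have e : ∀ v : Fin n → F4, ψ (hIP v c) * y ^ wt v =
      ∏ i, (ψ (v i * c i ^ 2) * (if v i = 0 then 1 else y)) := by
    intro v
    rw [Finset.prod_mul_distrib, pow_wt, hIP, map_sum_char]
  rw [Finset.sum_congr rfl fun a _ => e a,
    ← Fintype.piFinset_univ, ← Finset.prod_univ_sum (fun _ => Finset.univ)
      (fun i a => ψ (a * c i ^ 2) * (if a = 0 then 1 else y))]
  simp only [local_sum ψ hψ]
  rw [Finset.prod_ite]
  simp only [Finset.prod_const]
  have h1 := wt_eq c
  have h2 := Finset.card_filter_add_card_filter_not (s := (Finset.univ : Finset (Fin n))) (fun i => c i = 0)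
  simp only [Finset.card_univ, Fintype.card_fin] at h2
  have h3 : (Finset.univ.filter fun i => c i = 0).card = n - wt c := by
    rw [h1]; simp only [ne_eq]; omega
  rw [h3, ← h1, mul_comm]

open Classical in
lemma char_sum {n : ℕ} (ψ : AddChar F4 ℝ) (hψ : ψ ≠ 1) (C : Submodule F4 (Fin n → F4))
    (v : Fin n → F4) :
    ∑ c : C, ψ (hIP v c) = if v ∈ hDual C then (Fintype.card C : ℝ) else 0 := by
  split_ifs with h
  · have : ∀ c : C, ψ (hIP v c) = 1 := fun c => by
      rw [show hIP v c = 0 from h c c.2, AddChar.map_zero_eq_one]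
    simp [this]
  · have : ∃ c ∈ C, hIP v c ≠ 0 := by
      by_contra hh
      push Not at hh
      exact h hh
    obtain ⟨c, hc, hne⟩ := this
    obtain ⟨b, hb⟩ := AddChar.ne_one_iff.1 hψ
    let f : C →+ F4 := { toFun := fun c => hIP v c
                         map_zero' := by simp [hIP]
                         map_add' := fun a b => hIP_add_right v a b }
    have hne1 : ψ.compAddMonoidHom f ≠ 1 := by
      rw [AddChar.ne_one_iff]
      refine ⟨⟨(b / hIP v c) ^ 2 • c, C.smul_mem _ hc⟩, ?_⟩
      rw [AddChar.compAddMonoidHom_apply]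
      have : f ⟨(b / hIP v c) ^ 2 • c, C.smul_mem _ hc⟩ = b := by
        change hIP v ((b / hIP v c) ^ 2 • c) = b
        rw [hIP_smul_right, ← pow_mul, four]
        field_simp
      rwa [this]
    exact AddChar.sum_eq_zero_of_ne_one hne1

open Classical in
lemma macwilliams {n : ℕ} (C : Submodule F4 (Fin n → F4)) (hsd : C = hDual C) (y : ℝ) :
    ∑ c : C, (1 - y) ^ wt (c : Fin n → F4) * (1 + 3 * y) ^ (n - wt (c : Fin n → F4)) =
      Fintype.card C * ∑ c : C, y ^ wt (c : Fin n → F4) := by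
  obtain ⟨ψ, hψ⟩ := exists_char
  have e : ∀ c : C, (1 - y) ^ wt (c : Fin n → F4) * (1 + 3 * y) ^ (n - wt (c : Fin n → F4)) =
      ∑ v : Fin n → F4, ψ (hIP v (c : Fin n → F4)) * y ^ wt v := by
    intro c
    exact (full_sum ψ hψ (c : Fin n → F4) y).symm
  rw [Finset.sum_congr rfl fun c _ => e c, Finset.sum_comm]
  simp only [← Finset.sum_mul, char_sum ψ hψ C, ← hsd]
  simp only [ite_mul, zero_mul]
  rw [← Finset.sum_filter, ← Finset.mul_sum]
  congr 1
  exact Finset.sum_subtype _ (by simp) (fun v => y ^ wt v)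

open Classical in
lemma card_sq {n : ℕ} (C : Submodule F4 (Fin n → F4)) (hsd : C = hDual C) :
    (Fintype.card C : ℝ) ^ 2 = 4 ^ n := by
  have h := macwilliams C hsd 1
  rw [Finset.sum_eq_single (0 : C)] at h
  · simp [wt_zero] at h
    norm_num at h
    rw [h]; ring
  · intro c _ hc
    have : wt (c : Fin n → F4) ≠ 0 := wt_pos _ (by simpa using hc)
    simp [this]
  · simp

open Classical in
lemma card_eq {n : ℕ} (C : Submodule F4 (Fin n → F4)) (hsd : C = hDual C) :
    ∃ k, n = 2 * k ∧ (Fintype.card C : ℝ) = 4 ^ k := by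
  have h1 : Fintype.card C = 4 ^ Module.finrank F4 C := by
    rw [Module.card_eq_pow_finrank (K := F4), cardF4]
  have h2 := card_sq C hsd
  rw [h1] at h2
  refine ⟨Module.finrank F4 C, ?_, by rw [h1]; push_cast; rfl⟩
  have h3 : (4 ^ Module.finrank F4 C) ^ 2 = 4 ^ n := by exact_mod_cast h2
  rw [← pow_mul] at h3
  have := Nat.pow_right_injective (le_refl 2 |>.trans (by norm_num) : 2 ≤ 4) h3
  omega

end MOSW2

/-- The minimum weight `d` of a Hermitian self-dual code of length `n`
satisfies `d ≤ 2⌊n/6⌋ + 2`. -/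
theorem stmt13 {n d : ℕ} (hn : 0 < n) (C : Submodule F4 (Fin n → F4)) (hsd : C = hDual C)
    (hex : ∃ x ∈ C, x ≠ 0 ∧ wt x = d) (hmin : ∀ x ∈ C, x ≠ 0 → d ≤ wt x) :
    d ≤ 2 * (n / 6) + 2 := by
  classical
  by_contra hcon
  push Not at hcon
  obtain ⟨k, hk, hcard⟩ := MOSW2.card_eq C hsd
  have heven : ∀ c : C, Even (wt (c : Fin n → F4)) := by
    intro c
    apply MOSW2.wt_even
    have hc : (c : Fin n → F4) ∈ hDual C := hsd ▸ c.2
    exact hc c c.2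
  have hwt : ∀ c : C, 2 * (wt (c : Fin n → F4) / 2) = wt (c : Fin n → F4) :=
    fun c => Nat.two_mul_div_two_of_even (heven c)
  set V : Polynomial ℝ := ∑ c : C, Polynomial.X ^ (wt (c : Fin n → F4) / 2) with hV
  have hdeg : V.natDegree ≤ k := by
    refine Polynomial.natDegree_sum_le_of_forall_le _ _ fun c _ => ?_
    rw [Polynomial.natDegree_X_pow]
    have := MOSW2.wt_le (c : Fin n → F4)
    omega
  have hev : ∀ z : ℝ, V.eval (z ^ 2) = ∑ c : C, z ^ wt (c : Fin n → F4) := by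
    intro z
    rw [hV, Polynomial.eval_finsetSum]
    refine Finset.sum_congr rfl fun c _ => ?_
    rw [Polynomial.eval_pow, Polynomial.eval_X, ← pow_mul, hwt]
  obtain ⟨a, ha⟩ := MOSW.gleason k V hdeg (by
    intro y hy
    have h0 : 1 + 3 * y ≠ 0 := by positivity
    rw [hev, hev, ← hcard, ← MOSW2.macwilliams C hsd y, Finset.mul_sum]
    refine Finset.sum_congr rfl fun c _ => ?_
    have h1 := MOSW2.wt_le (c : Fin n → F4)
    have h2 : 2 * k = (n - wt (c : Fin n → F4)) + wt (c : Fin n → F4) := by omega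
    rw [h2, pow_add, div_pow]
    field_simp)
  refine MOSW.no_extremal k (by omega) a V ha ?_ ?_
  · rw [hV, Polynomial.finsetSum_coeff, Finset.sum_eq_single (0 : C)]
    · simp [MOSW2.wt_zero]
    · intro c _ hc
      have h1 : wt (c : Fin n → F4) ≠ 0 := MOSW2.wt_pos _ (by simpa using hc)
      have h2 := hwt c
      rw [Polynomial.coeff_X_pow, if_neg (by omega)]
    · simp
  · intro i hi1 hi2
    rw [hV, Polynomial.finsetSum_coeff]
    refine Finset.sum_eq_zero fun c _ => ?_
    rw [Polynomial.coeff_X_pow, if_neg]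
    intro h
    have h2 := hwt c
    by_cases hc : (c : Fin n → F4) = 0
    · rw [hc, MOSW2.wt_zero] at h
      omega
    · have := hmin c c.2 hc
      omega
end
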